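/- Let G = (V,E) be a finite simple graph satisfying the Laman conditions. Then for any two generic edge-length assignments λ, λ′ : E → ℝ_{>0}, the sets of congruence classes of spherical realizations of G inducing λ and inducing λ′ are both finite, nonempty, and have the same cardinality. -/

import Mathlib

/-- A finite simple graph: vertices are a finite set of naturals, edges are
two-element subsets of the vertex set. -/
structure GeoGraph where
  V : Finset ℕ
  E : Finset (Finset ℕ)
  edge_sub : ∀ e ∈ E, e ⊆ V
  edge_two : ∀ e ∈ E, e.card = 2

def IsSubgraph (G' G : GeoGraph) : Prop :=
  G'.V ⊆ G.V ∧ G'.E ⊆ G.E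

/-- The Laman conditions: `|E| = 2|V| - 3` and every subgraph with at least two
vertices satisfies `|E'| ≤ 2|V'| - 3`. -/
def Laman (G : GeoGraph) : Prop :=
  2 ≤ G.V.card ∧ G.E.card = 2 * G.V.card - 3 ∧
    ∀ G' : GeoGraph, IsSubgraph G' G → 2 ≤ G'.V.card → G'.E.card ≤ 2 * G'.V.card - 3

/-- A generic edge-length assignment: positive real edge lengths that are
algebraically independent over ℚ. -/
def Generic (G : GeoGraph) (lam : Finset ℕ → ℝ) : Prop :=
  (∀ e ∈ G.E, 0 < lam e) ∧
    AlgebraicIndependent ℚ (fun e : G.E => lam e.1)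

/-- A spherical realization: every vertex goes to the complex sphere. -/
def SphereRealization (G : GeoGraph) (ρ : ℕ → Fin 3 → ℂ) : Prop :=
  ∀ v ∈ G.V, ∑ i, ρ v i ^ 2 = 1

/-- A realization induces the edge lengths `lam`. -/
def SphereInduces (G : GeoGraph) (ρ : ℕ → Fin 3 → ℂ) (lam : Finset ℕ → ℝ) : Prop :=
  ∀ u v : ℕ, ({u, v} : Finset ℕ) ∈ G.E →
    ∑ i, (ρ u i - ρ v i) ^ 2 = (lam {u, v} : ℂ)

/-- Congruence of spherical realizations via `SO₃(ℂ)`. -/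
def SphereCongruent (G : GeoGraph) (ρ ρ' : ℕ → Fin 3 → ℂ) : Prop :=
  ∃ A : Matrix (Fin 3) (Fin 3) ℂ, A * A.transpose = 1 ∧ A.det = 1 ∧
    ∀ v ∈ G.V, ρ' v = A.mulVec (ρ v)

/-- Congruence classes of spherical realizations of `G` inducing `lam`. -/
def SphereClasses (G : GeoGraph) (lam : Finset ℕ → ℝ) : Type :=
  Quot fun ρ ρ' : {ρ : ℕ → Fin 3 → ℂ // SphereRealization G ρ ∧ SphereInduces G ρ lam} =>
    SphereCongruent G ρ.1 ρ'.1

def PlaneInduces (G : GeoGraph) (ρ : ℕ → Fin 2 → ℂ) (lam : Finset ℕ → ℝ) : Prop :=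
  ∀ u v : ℕ, ({u, v} : Finset ℕ) ∈ G.E →
    ∑ i, (ρ u i - ρ v i) ^ 2 = (lam {u, v} : ℂ)

/-- Congruence of plane realizations via `SO₂(ℂ)` and a translation. -/
def PlaneCongruent (G : GeoGraph) (ρ ρ' : ℕ → Fin 2 → ℂ) : Prop :=
  ∃ A : Matrix (Fin 2) (Fin 2) ℂ, ∃ b : Fin 2 → ℂ, A * A.transpose = 1 ∧ A.det = 1 ∧
    ∀ v ∈ G.V, ρ' v = A.mulVec (ρ v) + b

/-- Congruence classes of plane realizations of `G` inducing `lam`. -/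
def PlaneClasses (G : GeoGraph) (lam : Finset ℕ → ℝ) : Type :=
  Quot fun ρ ρ' : {ρ : ℕ → Fin 2 → ℂ // PlaneInduces G ρ lam} =>
    PlaneCongruent G ρ.1 ρ'.1

/-- A calligraph: `{0,1,2} ⊆ V`, `{1,2} ∈ E`, `|E| = 2|V| - 4`, and adding the
edge `{0,1}` or the edge `{0,2}` yields a graph satisfying the Laman conditions. -/
def Calligraph (H : GeoGraph) : Prop :=
  ({0, 1, 2} : Finset ℕ) ⊆ H.V ∧ ({1, 2} : Finset ℕ) ∈ H.E ∧
    H.E.card = 2 * H.V.card - 4 ∧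
    ((∃ H' : GeoGraph, H'.V = H.V ∧ H'.E = insert {0, 1} H.E ∧ Laman H') ∨
     (∃ H' : GeoGraph, H'.V = H.V ∧ H'.E = insert {0, 2} H.E ∧ Laman H'))

/-- A split of `G` into two subgraphs sharing exactly the vertices `0,1,2` and
the edge `{1,2}`. -/
def IsSplit (G G₁ G₂ : GeoGraph) : Prop :=
  G.V = G₁.V ∪ G₂.V ∧ G.E = G₁.E ∪ G₂.E ∧
    G₁.V ∩ G₂.V = ({0, 1, 2} : Finset ℕ) ∧
    G₁.E ∩ G₂.E = ({{1, 2}} : Finset (Finset ℕ))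

/-- A calligraphic split: a split into two calligraphs. -/
def CalligraphicSplit (G G₁ G₂ : GeoGraph) : Prop :=
  IsSplit G G₁ G₂ ∧ Calligraph G₁ ∧ Calligraph G₂

section FieldIsomorphisms

open Cardinal

/-- Uncountable algebraically closed fields of equal cardinality over a countable base ring
are isomorphic over that ring. -/
theorem exists_ringEquiv_of_countable_base {R K L : Type} [CommRing R] [IsDomain R] [Countable R]
    [Field K] [Field L] [IsAlgClosed K] [IsAlgClosed L] [Algebra R K] [Algebra R L]
    [FaithfulSMul R K] [FaithfulSMul R L] (hK : ℵ₀ < #K) (hKL : #K = #L) :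
    ∃ σ : K ≃+* L, ∀ r : R, σ (algebraMap R K r) = algebraMap R L r := by
  obtain ⟨s, hs⟩ := exists_isTranscendenceBasis R K
  obtain ⟨t, ht⟩ := exists_isTranscendenceBasis R L
  have hR : #R ≤ ℵ₀ := mk_le_aleph0
  have h1 := IsAlgClosed.cardinal_eq_cardinal_transcendence_basis_of_aleph0_lt' _ hs hR hK
  have h2 := IsAlgClosed.cardinal_eq_cardinal_transcendence_basis_of_aleph0_lt' _ ht hR (hKL ▸ hK)
  obtain ⟨e⟩ := Cardinal.eq.1 (h1.symm.trans (hKL.trans h2))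
  let := IsAlgClosed.isAlgClosure_of_transcendence_basis _ hs
  let := IsAlgClosed.isAlgClosure_of_transcendence_basis _ ht
  let f : Algebra.adjoin R (Set.range ((↑) : s → K)) ≃ₐ[R]
      Algebra.adjoin R (Set.range ((↑) : t → L)) :=
    hs.1.aevalEquiv.symm.trans ((MvPolynomial.renameEquiv R e).trans ht.1.aevalEquiv)
  refine ⟨IsAlgClosure.equivOfEquiv K L f.toRingEquiv, fun r => ?_⟩
  rw [IsScalarTower.algebraMap_apply R (Algebra.adjoin R (Set.range ((↑) : s → K))) K,
    IsAlgClosure.equivOfEquiv_algebraMap,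
    IsScalarTower.algebraMap_apply R (Algebra.adjoin R (Set.range ((↑) : t → L))) L]
  congr 1
  exact f.commutes r

/-- Finite algebraically independent families of complex numbers with the same index type are
conjugate under the automorphism group of `ℂ`. -/
theorem exists_complex_ringEquiv {ι : Type} [Finite ι] {x y : ι → ℂ}
    (hx : AlgebraicIndependent ℚ x) (hy : AlgebraicIndependent ℚ y) :
    ∃ σ : ℂ ≃+* ℂ, ∀ i, σ (x i) = y i := by
  have hc : Countable (MvPolynomial ι ℚ) := by
    rw [← mk_le_aleph0_iff]
    exact MvPolynomial.cardinalMk_le_max.trans (by simp)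
  have hK : ℵ₀ < #ℂ := by
    rw [Cardinal.mk_complex]
    exact aleph0_lt_continuum
  have faithful {z : ι → ℂ} (hz : AlgebraicIndependent ℚ z) :
      let := (MvPolynomial.aeval (R := ℚ) z).toAlgebra
      FaithfulSMul (MvPolynomial ι ℚ) ℂ := by
    intro
    exact (faithfulSMul_iff_algebraMap_injective _ _).2 hz
  obtain ⟨σ, hσ⟩ := @exists_ringEquiv_of_countable_base (MvPolynomial ι ℚ) ℂ ℂ _ _ hc _ _ _ _
    (MvPolynomial.aeval x).toAlgebra (MvPolynomial.aeval y).toAlgebra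
    (faithful hx) (faithful hy) hK rfl
  refine ⟨σ, fun i => ?_⟩
  have := hσ (MvPolynomial.X i)
  simpa [RingHom.algebraMap_toAlgebra] using this

end FieldIsomorphisms

section Transport

theorem SphereRealization.map {G : GeoGraph} {ρ : ℕ → Fin 3 → ℂ} (h : SphereRealization G ρ)
    (σ : ℂ ≃+* ℂ) : SphereRealization G fun v i => σ (ρ v i) := fun v hv => by
  simpa using congrArg σ (h v hv)

theorem SphereInduces.map {G : GeoGraph} {ρ : ℕ → Fin 3 → ℂ} {lam lam' : Finset ℕ → ℝ}
    (h : SphereInduces G ρ lam) {σ : ℂ ≃+* ℂ} (hσ : ∀ e ∈ G.E, σ (lam e) = lam' e) :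
    SphereInduces G (fun v i => σ (ρ v i)) lam' := fun u v huv => by
  rw [← hσ _ huv, ← h u v huv]
  simp

theorem SphereCongruent.map {G : GeoGraph} {ρ ρ' : ℕ → Fin 3 → ℂ} (h : SphereCongruent G ρ ρ')
    (σ : ℂ ≃+* ℂ) :
    SphereCongruent G (fun v i => σ (ρ v i)) fun v i => σ (ρ' v i) := by
  obtain ⟨A, hA, hdet, hρ⟩ := h
  refine ⟨A.map σ, ?_, ?_, fun v hv => ?_⟩
  · rw [← Matrix.transpose_map, ← Matrix.map_mul, hA, Matrix.map_one _ (map_zero σ) (map_one σ)]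
  · simpa [hdet] using (σ.toRingHom.map_det A).symm
  · ext i
    simp [hρ v hv, Matrix.mulVec, dotProduct]

/-- An automorphism of `ℂ` carrying `lam` to `lam'` maps congruence classes to congruence
classes. -/
def SphereClasses.map {G : GeoGraph} {lam lam' : Finset ℕ → ℝ} (σ : ℂ ≃+* ℂ)
    (hσ : ∀ e ∈ G.E, σ (lam e) = lam' e) : SphereClasses G lam → SphereClasses G lam' :=
  Quot.map (fun ρ => ⟨fun v i => σ (ρ.1 v i), ρ.2.1.map σ, ρ.2.2.map hσ⟩)
    fun _ _ h => h.map σ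

theorem SphereClasses.nonempty_equiv {G : GeoGraph} {lam lam' : Finset ℕ → ℝ}
    (h : AlgebraicIndependent ℚ (fun e : G.E => lam e.1))
    (h' : AlgebraicIndependent ℚ (fun e : G.E => lam' e.1)) :
    Nonempty (SphereClasses G lam ≃ SphereClasses G lam') := by
  have toComplex {x : G.E → ℝ} (hx : AlgebraicIndependent ℚ x) :
      AlgebraicIndependent ℚ fun e => (x e : ℂ) :=
    hx.map' (f := Complex.ofRealAm.restrictScalars ℚ) Complex.ofReal_injective
  obtain ⟨σ, hσ⟩ := exists_complex_ringEquiv (toComplex h) (toComplex h')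
  have h1 : ∀ e ∈ G.E, σ (lam e) = lam' e := fun e he => hσ ⟨e, he⟩
  have h2 : ∀ e ∈ G.E, σ.symm (lam' e) = lam e := fun e he => by
    rw [← h1 e he, RingEquiv.symm_apply_apply]
  exact ⟨SphereClasses.map σ h1, SphereClasses.map σ.symm h2,
    Quot.ind fun ρ => congrArg (Quot.mk _) (by simp),
    Quot.ind fun ρ => congrArg (Quot.mk _) (by simp)⟩

end Transport

section Finiteness

/-- A domain generated over a field by finitely many algebraic elements is a field. -/
theorem isField_of_surjective_of_isAlgebraic {K ι B : Type} [Field K] [CommRing B] [IsDomain B]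
    [Algebra K B] {π : MvPolynomial ι K →ₐ[K] B} (hπ : Function.Surjective π)
    (h : ∀ i, IsAlgebraic K (π (MvPolynomial.X i))) : IsField B := by
  have : Algebra.IsIntegral K B := by
    refine ⟨fun y => ?_⟩
    obtain ⟨f, rfl⟩ := hπ y
    induction f using MvPolynomial.induction_on with
    | C a => simpa [← MvPolynomial.algebraMap_eq] using isIntegral_algebraMap
    | add p q hp hq => simpa using hp.add hq
    | mul_X p i hp => simpa using hp.mul (h i).isIntegral
  exact isField_of_isIntegral_of_isField' (Field.toIsField K)

/-- A system of polynomial equations over a field `K` all of whose solutions in all extension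
fields have algebraic coordinates has only finitely many solutions in each extension field. -/
theorem finite_zeros_of_forall_isAlgebraic {K ι : Type} [Field K] [Finite ι]
    (S : Set (MvPolynomial ι K))
    (h : ∀ (F : Type) [Field F] [Algebra K F] (x : ι → F),
      (∀ f ∈ S, MvPolynomial.aeval x f = 0) → ∀ i, IsAlgebraic K (x i))
    (L : Type) [Field L] [Algebra K L] :
    {x : ι → L | ∀ f ∈ S, MvPolynomial.aeval x f = 0}.Finite := by
  let I := Ideal.span S
  have isField (B : Type) [CommRing B] [IsDomain B] [Algebra K B]
      (π : MvPolynomial ι K →ₐ[K] B) (hπ : Function.Surjective π) (hS : ∀ f ∈ S, π f = 0) :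
      IsField B := by
    refine isField_of_surjective_of_isAlgebraic hπ fun i => ?_
    let φ : MvPolynomial ι K →ₐ[K] FractionRing B :=
      (IsScalarTower.toAlgHom K B (FractionRing B)).comp π
    have hφ : MvPolynomial.aeval (fun i => φ (MvPolynomial.X i)) = φ :=
      (MvPolynomial.aeval_unique φ).symm
    refine (isAlgebraic_algebraMap_iff (IsFractionRing.injective B (FractionRing B))).1
      (h (FractionRing B) (fun i => φ (MvPolynomial.X i)) (fun f hf => ?_) i)
    rw [hφ]
    simp [φ, hS f hf]
  have hdim : Ring.KrullDimLE 0 (MvPolynomial ι K ⧸ I) := by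
    refine Ring.KrullDimLE.mk₀ fun P hP => ?_
    have hP' : IsField ((MvPolynomial ι K ⧸ I) ⧸ P) := isField ((MvPolynomial ι K ⧸ I) ⧸ P)
      ((Ideal.Quotient.mkₐ K P).comp (Ideal.Quotient.mkₐ K I))
      ((Ideal.Quotient.mkₐ_surjective K P).comp (Ideal.Quotient.mkₐ_surjective K I))
      fun f hf => by
        have : Ideal.Quotient.mk I f = 0 :=
          Ideal.Quotient.eq_zero_iff_mem.2 (Ideal.subset_span hf)
        change Ideal.Quotient.mk P (Ideal.Quotient.mk I f) = 0
        rw [this, map_zero]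
    exact Ideal.Quotient.maximal_of_isField _ hP'
  have : Module.Finite K (MvPolynomial ι K ⧸ I) := (Module.finite_iff_krullDimLE_zero K _).2 hdim
  refine (Set.finite_range fun (ψ : (MvPolynomial ι K ⧸ I) →ₐ[K] L) i =>
    ψ (Ideal.Quotient.mk I (MvPolynomial.X i))).subset fun x hx => ?_
  have hI : ∀ f ∈ I, MvPolynomial.aeval x f = 0 := fun f hf =>
    (Ideal.span_le (I := RingHom.ker (MvPolynomial.aeval (R := K) x))).2 hx hf
  exact ⟨Ideal.Quotient.liftₐ I (MvPolynomial.aeval x) hI,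
    funext fun i => (Ideal.Quotient.lift_mk I _ _).trans (MvPolynomial.aeval_X x i)⟩

/-- If the members of a finite algebraically independent family are algebraic over a set with at
most as many elements, then everything algebraic over that set is algebraic over the family. -/
theorem isAlgebraic_adjoin_range_of_card_le {F ι : Type} [Field F] [Algebra ℚ F] [Fintype ι]
    {x : ι → F} (hx : AlgebraicIndependent ℚ x) (T : Finset F)
    (hT : ∀ i, IsAlgebraic (Algebra.adjoin ℚ (T : Set F)) (x i))
    (hcard : T.card ≤ Fintype.card ι) {y : F}
    (hy : IsAlgebraic (Algebra.adjoin ℚ (T : Set F)) y) :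
    IsAlgebraic (Algebra.adjoin ℚ (Set.range x)) y := by
  let M := AlgebraicIndependent.matroid ℚ F
  have mem_closure {s : Set F} {z : F} : z ∈ M.closure s ↔ IsAlgebraic (Algebra.adjoin ℚ s) z := by
    rw [AlgebraicIndependent.matroid_closure_eq]
    rfl
  have hsub : Set.range x ⊆ M.closure T := Set.range_subset_iff.2 fun i => mem_closure.2 (hT i)
  obtain ⟨J, hJ, hxJ⟩ := Matroid.Indep.subset_isBasis_of_subset (M := M) hx.to_subtype_range hsub
  have hJ_card : J.encard ≤ (Set.range x).encard := by
    rw [hJ.encard_eq_eRk, Matroid.eRk_closure_eq]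
    refine (M.eRk_le_encard _).trans ?_
    rw [Set.encard_coe_eq_coe_finsetCard, ← Set.image_univ, hx.injective.encard_image,
      Set.encard_univ, ENat.card_eq_coe_fintype_card]
    exact_mod_cast hcard
  have hJ_eq := (Set.finite_range x).eq_of_subset_of_encard_le hxJ hJ_card
  rw [← mem_closure] at hy ⊢
  rwa [hJ_eq, hJ.closure_eq_closure, M.closure_closure]

end Finiteness

section PinnedRealizations

open Matrix

/-- The matrix with rows `p`, `q` and `p × q`. -/
def crossFrame (p q : Fin 3 → ℂ) : Matrix (Fin 3) (Fin 3) ℂ :=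
  Matrix.of ![p, q, crossProduct p q]

theorem crossFrame_mul_transpose (p q : Fin 3 → ℂ) :
    crossFrame p q * (crossFrame p q)ᵀ =
      !![p ⬝ᵥ p, p ⬝ᵥ q, 0; p ⬝ᵥ q, q ⬝ᵥ q, 0; 0, 0, (p ⬝ᵥ p) * (q ⬝ᵥ q) - (p ⬝ᵥ q) ^ 2] := by
  ext i j
  fin_cases i <;> fin_cases j <;>
    simp [crossFrame, Matrix.mul_apply, Fin.sum_univ_three, cross_apply, dotProduct] <;> ring

theorem det_crossFrame (p q : Fin 3 → ℂ) :
    (crossFrame p q).det = (p ⬝ᵥ p) * (q ⬝ᵥ q) - (p ⬝ᵥ q) ^ 2 := by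
  simp [crossFrame, Matrix.det_fin_three, cross_apply, dotProduct, Fin.sum_univ_three]
  ring

theorem exists_rotation {p q α β : Fin 3 → ℂ} (hp : p ⬝ᵥ p = α ⬝ᵥ α) (hq : q ⬝ᵥ q = β ⬝ᵥ β)
    (hpq : p ⬝ᵥ q = α ⬝ᵥ β) (h0 : (α ⬝ᵥ α) * (β ⬝ᵥ β) - (α ⬝ᵥ β) ^ 2 ≠ 0) :
    ∃ A : Matrix (Fin 3) (Fin 3) ℂ, A * Aᵀ = 1 ∧ A.det = 1 ∧ A *ᵥ p = α ∧ A *ᵥ q = β := by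
  have hgram : crossFrame p q * (crossFrame p q)ᵀ = crossFrame α β * (crossFrame α β)ᵀ := by
    simp only [crossFrame_mul_transpose, hp, hq, hpq]
  have hdet : (crossFrame p q).det = (crossFrame α β).det := by
    simp only [det_crossFrame, hp, hq, hpq]
  have hdet0 : (crossFrame p q).det ≠ 0 := by rwa [hdet, det_crossFrame]
  have hP : IsUnit (crossFrame p q).det := hdet0.isUnit
  have hPt : IsUnit (crossFrame p q)ᵀ.det := by rwa [Matrix.det_transpose]
  have hQ : IsUnit (crossFrame α β).det := hdet ▸ hP
  obtain ⟨A, hA⟩ : ∃ A, A * (crossFrame p q)ᵀ = (crossFrame α β)ᵀ :=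
    ⟨_, Matrix.nonsing_inv_mul_cancel_right _ _ hPt⟩
  have col (k : Fin 3) : A *ᵥ (crossFrame p q k) = crossFrame α β k := by
    ext i
    exact congrFun (congrFun hA i) k
  refine ⟨A, ?_, ?_, col 0, col 1⟩
  · refine mul_eq_one_comm.1 ?_
    have h1 : crossFrame p q * Aᵀ = crossFrame α β := by
      simpa using congrArg Matrix.transpose hA
    have h2 : crossFrame p q * (Aᵀ * A) * (crossFrame p q)ᵀ =
        crossFrame p q * 1 * (crossFrame p q)ᵀ := by
      rw [mul_one, hgram, ← hA, ← mul_assoc, h1, mul_assoc]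
    exact ((Matrix.isUnit_iff_isUnit_det _).2 hP).mul_left_cancel
      (((Matrix.isUnit_iff_isUnit_det _).2 hPt).mul_right_cancel h2)
  · have := congrArg Matrix.det hA
    rw [Matrix.det_mul, Matrix.det_transpose, Matrix.det_transpose, hdet] at this
    exact mul_right_cancel₀ (hdet ▸ hdet0) (this.trans (one_mul _).symm)

/-- The spherical realizations inducing `lam`, restricted to the vertex set, that send `a` and `b`
to prescribed points `α` and `β`. -/
def pinnedRealizations (G : GeoGraph) (lam : Finset ℕ → ℝ) (a b : G.V) (α β : Fin 3 → ℂ) :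
    Set (G.V × Fin 3 → ℂ) :=
  {z | (∀ i, z (a, i) = α i) ∧ (∀ i, z (b, i) = β i) ∧ (∀ v, ∑ i, z (v, i) ^ 2 = 1) ∧
    ∀ u v : G.V, ({u.1, v.1} : Finset ℕ) ∈ G.E →
      ∑ i, (z (u, i) - z (v, i)) ^ 2 = (lam {u.1, v.1} : ℂ)}

theorem pinnedRealizations_finite {G : GeoGraph} (hG : G.E.card = 2 * G.V.card - 3)
    {lam : Finset ℕ → ℝ} (hlam : AlgebraicIndependent ℚ (fun e : G.E => lam e.1)) {a b : G.V}
    (hab : a ≠ b) {c s : ℂ} (hcs : c ^ 2 + s ^ 2 = 1) :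
    (pinnedRealizations G lam a b ![1, 0, 0] ![c, s, 0]).Finite := by
  let Z := pinnedRealizations G lam a b ![1, 0, 0] ![c, s, 0]
  refine (finite_zeros_of_forall_isAlgebraic
    {f : MvPolynomial (G.V × Fin 3) ℂ | ∀ z ∈ Z, MvPolynomial.aeval z f = 0}
    (fun F _ _ x hx => ?_) ℂ).subset fun z hz f hf => hf z hz
  have : CharZero F := charZero_of_injective_algebraMap (algebraMap ℂ F).injective
  have eqn (f : MvPolynomial (G.V × Fin 3) ℂ) (hf : ∀ z ∈ Z, MvPolynomial.aeval z f = 0) :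
      MvPolynomial.aeval x f = 0 := hx f hf
  have ha (i) : x (a, i) = algebraMap ℂ F ((![1, 0, 0] : Fin 3 → ℂ) i) := by
    simpa [sub_eq_zero] using
      eqn (.X (a, i) - .C ((![1, 0, 0] : Fin 3 → ℂ) i)) fun z hz => by simp [hz.1]
  have hb (i) : x (b, i) = algebraMap ℂ F ((![c, s, 0] : Fin 3 → ℂ) i) := by
    simpa [sub_eq_zero] using
      eqn (.X (b, i) - .C ((![c, s, 0] : Fin 3 → ℂ) i)) fun z hz => by simp [hz.2.1]
  have hsphere (v) : x (v, 0) ^ 2 + x (v, 1) ^ 2 + x (v, 2) ^ 2 = 1 := by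
    have h := eqn (.X (v, 0) ^ 2 + .X (v, 1) ^ 2 + .X (v, 2) ^ 2 - 1) fun z hz => by
      simpa [sub_eq_zero, Fin.sum_univ_three] using hz.2.2.1 v
    simpa only [map_sub, map_add, map_pow, MvPolynomial.aeval_X, map_one, sub_eq_zero] using h
  have hlen (u v : G.V) (huv : ({u.1, v.1} : Finset ℕ) ∈ G.E) :
      (x (u, 0) - x (v, 0)) ^ 2 + (x (u, 1) - x (v, 1)) ^ 2 + (x (u, 2) - x (v, 2)) ^ 2 =
        algebraMap ℂ F (lam {u.1, v.1}) := by
    have h := eqn ((.X (u, 0) - .X (v, 0)) ^ 2 + (.X (u, 1) - .X (v, 1)) ^ 2 +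
        (.X (u, 2) - .X (v, 2)) ^ 2 - .C (lam {u.1, v.1} : ℂ)) fun z hz => by
      simpa [sub_eq_zero, Fin.sum_univ_three] using hz.2.2.2 u v huv
    simpa only [map_sub, map_add, map_pow, MvPolynomial.aeval_X, MvPolynomial.aeval_C,
      sub_eq_zero] using h
  classical
  let T : Finset F := insert (algebraMap ℂ F c)
    ((((Finset.univ.erase a).erase b) ×ˢ ({0, 1} : Finset (Fin 3))).image x)
  let R := Algebra.adjoin ℚ (T : Set F)
  have memT {y : F} (hy : y ∈ T) : IsAlgebraic R y :=
    isAlgebraic_algebraMap (⟨y, Algebra.subset_adjoin hy⟩ : R)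
  have hxR (v : G.V) : ∀ i, IsAlgebraic R (x (v, i)) := by
    have h2 (h0 : IsAlgebraic R (x (v, 0))) (h1 : IsAlgebraic R (x (v, 1))) :
        IsAlgebraic R (x (v, 2)) := by
      have h := hsphere v
      refine IsAlgebraic.of_pow two_pos ?_
      rw [show x (v, 2) ^ 2 = 1 - x (v, 0) ^ 2 - x (v, 1) ^ 2 by rw [← h]; ring]
      exact (isAlgebraic_one.sub (h0.pow 2)).sub (h1.pow 2)
    have h01 : IsAlgebraic R (x (v, 0)) ∧ IsAlgebraic R (x (v, 1)) := by
      by_cases hva : v = a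
      · subst hva
        simp [ha, isAlgebraic_one, isAlgebraic_zero]
      by_cases hvb : v = b
      · subst hvb
        have hc : IsAlgebraic R (algebraMap ℂ F c) := memT (Finset.mem_insert_self _ _)
        refine ⟨by simpa [hb] using hc, IsAlgebraic.of_pow two_pos ?_⟩
        have hs : x (v, 1) ^ 2 = 1 - algebraMap ℂ F c ^ 2 := by
          rw [hb, ← map_one (algebraMap ℂ F), ← hcs]
          simp
        rw [hs]
        exact isAlgebraic_one.sub (hc.pow 2)
      · have h (i : Fin 3) (hi : i ∈ ({0, 1} : Finset (Fin 3))) : IsAlgebraic R (x (v, i)) :=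
          memT (Finset.mem_insert_of_mem (Finset.mem_image_of_mem _ (by simp_all)))
        exact ⟨h 0 (by simp), h 1 (by simp)⟩
    intro i
    fin_cases i
    · exact h01.1
    · exact h01.2
    · exact h2 h01.1 h01.2
  have hcard : T.card ≤ Fintype.card G.E := by
    have h1 : T.card ≤ ((((Finset.univ : Finset G.V).erase a).erase b).card * 2) + 1 := by
      refine (Finset.card_insert_le _ _).trans (Nat.succ_le_succ ?_)
      refine Finset.card_image_le.trans ?_
      simp [Finset.card_product]
    have h2 : 1 < (Finset.univ : Finset G.V).card :=
      Finset.one_lt_card.2 ⟨a, Finset.mem_univ _, b, Finset.mem_univ _, hab⟩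
    rw [Finset.card_erase_of_mem (by simp [hab.symm]), Finset.card_erase_of_mem (by simp)] at h1
    simp only [Finset.card_univ, Fintype.card_coe] at h1 h2 ⊢
    omega
  let φ : ℝ →ₐ[ℚ] F := ((IsScalarTower.toAlgHom ℚ ℂ F).comp
    (Complex.ofRealAm.restrictScalars ℚ))
  have hind : AlgebraicIndependent ℚ fun e : G.E => φ (lam e.1) :=
    hlam.map' (f := φ) φ.injective
  have hlamR (e : G.E) : IsAlgebraic R (φ (lam e.1)) := by
    obtain ⟨e, he⟩ := e
    obtain ⟨u, v, huv, rfl⟩ := Finset.card_eq_two.1 (G.edge_two e he)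
    have hsub := G.edge_sub _ he
    have h := hlen ⟨u, hsub (by simp)⟩ ⟨v, hsub (by simp)⟩ he
    change IsAlgebraic R (algebraMap ℂ F (lam {u, v}))
    have hsq (i) := ((hxR ⟨u, hsub (by simp)⟩ i).sub (hxR ⟨v, hsub (by simp)⟩ i)).pow 2
    rw [← h]
    exact ((hsq 0).add (hsq 1)).add (hsq 2)
  rintro ⟨v, i⟩
  have hle : Algebra.adjoin ℚ (Set.range fun e : G.E => φ (lam e.1)) ≤
      (⊥ : Subalgebra ℂ F).restrictScalars ℚ :=
    Algebra.adjoin_le (Set.range_subset_iff.2 fun e =>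
      Algebra.mem_bot.2 (Set.mem_range_self (lam e.1 : ℂ)))
  exact Subalgebra.isAlgebraic_of_isAlgebraic_bot (IsAlgebraic.tower_top_of_subalgebra_le hle
    (isAlgebraic_adjoin_range_of_card_le hind T hlamR hcard (hxR v i)))

/-- Extend a pinned realization by zero off the vertex set. -/
def pinnedToRealization {G : GeoGraph} {lam : Finset ℕ → ℝ} {a b : G.V} {α β : Fin 3 → ℂ}
    (z : pinnedRealizations G lam a b α β) :
    {ρ : ℕ → Fin 3 → ℂ // SphereRealization G ρ ∧ SphereInduces G ρ lam} :=
  ⟨fun v i => if h : v ∈ G.V then z.1 (⟨v, h⟩, i) else 0,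
    fun v hv => by simpa [hv] using z.2.2.2.1 ⟨v, hv⟩,
    fun u v huv => by
      have hu : u ∈ G.V := G.edge_sub _ huv (by simp)
      have hv : v ∈ G.V := G.edge_sub _ huv (by simp)
      simpa [hu, hv] using z.2.2.2.2 ⟨u, hu⟩ ⟨v, hv⟩ huv⟩

theorem sum_sq_mulVec_eq {A : Matrix (Fin 3) (Fin 3) ℂ} (hA : A * Aᵀ = 1) (w : Fin 3 → ℂ) :
    ∑ i, (A *ᵥ w) i ^ 2 = ∑ i, w i ^ 2 := by
  have : (A *ᵥ w) ⬝ᵥ (A *ᵥ w) = w ⬝ᵥ w := by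
    rw [Matrix.dotProduct_mulVec, ← Matrix.mulVec_transpose, Matrix.mulVec_mulVec,
      mul_eq_one_comm.1 hA, Matrix.one_mulVec]
  simpa [dotProduct, pow_two] using this

/-- Every congruence class is represented by a pinned realization. -/
theorem pinnedToRealization_surjective {G : GeoGraph} {lam : Finset ℕ → ℝ} {a b : G.V}
    (hab : ({a.1, b.1} : Finset ℕ) ∈ G.E) {α β : Fin 3 → ℂ} (hα : α ⬝ᵥ α = 1) (hβ : β ⬝ᵥ β = 1)
    (hαβ : 2 - 2 * (α ⬝ᵥ β) = lam {a.1, b.1}) (h0 : 1 - (α ⬝ᵥ β) ^ 2 ≠ 0) :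
    Function.Surjective fun z : pinnedRealizations G lam a b α β =>
      (Quot.mk _ (pinnedToRealization z) : SphereClasses G lam) := by
  intro q
  obtain ⟨⟨ρ, hρ, hρ'⟩, rfl⟩ := Quot.exists_rep q
  have ha : ρ a ⬝ᵥ ρ a = 1 := by simpa [dotProduct, pow_two] using hρ a a.2
  have hb : ρ b ⬝ᵥ ρ b = 1 := by simpa [dotProduct, pow_two] using hρ b b.2
  have hdot : ρ a ⬝ᵥ ρ b = α ⬝ᵥ β := by
    have h := hρ' a b hab
    rw [← hαβ] at h
    simp only [Fin.sum_univ_three, dotProduct] at ha hb h ⊢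
    linear_combination (1 / 2) * ha + (1 / 2) * hb - (1 / 2) * h
  obtain ⟨A, hA, hdet, hAa, hAb⟩ := exists_rotation (ha.trans hα.symm) (hb.trans hβ.symm) hdot
    (by rwa [hα, hβ, one_mul])
  have hz : (fun w : G.V × Fin 3 => (A *ᵥ ρ w.1) w.2) ∈ pinnedRealizations G lam a b α β := by
    refine ⟨fun i => congrFun hAa i, fun i => congrFun hAb i, fun v => ?_, fun u v huv => ?_⟩
    · exact (sum_sq_mulVec_eq hA (ρ v)).trans (hρ v v.2)
    · have h := (sum_sq_mulVec_eq hA (ρ u - ρ v)).trans (hρ' u v huv)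
      rwa [Matrix.mulVec_sub] at h
  refine ⟨⟨_, hz⟩, (Quot.sound ?_).symm⟩
  refine ⟨A, hA, hdet, fun v hv => ?_⟩
  ext i
  simp [pinnedToRealization, hv]

theorem sphereClasses_finite {G : GeoGraph} (hG : G.E.card = 2 * G.V.card - 3)
    (hV : 2 ≤ G.V.card) {lam : Finset ℕ → ℝ}
    (hlam : AlgebraicIndependent ℚ (fun e : G.E => lam e.1)) : Finite (SphereClasses G lam) := by
  obtain ⟨e, he⟩ : G.E.Nonempty := Finset.card_pos.1 (by omega)
  obtain ⟨a, b, hab, rfl⟩ := Finset.card_eq_two.1 (G.edge_two e he)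
  obtain ⟨c, hc⟩ : ∃ c : ℂ, 2 - 2 * c = lam {a, b} := ⟨1 - lam {a, b} / 2, by ring⟩
  obtain ⟨s, hs⟩ := IsAlgClosed.exists_pow_nat_eq (1 - c ^ 2) two_pos
  have hcs : c ^ 2 + s ^ 2 = 1 := by rw [hs]; ring
  have hc0 : 1 - c ^ 2 ≠ 0 := by
    have htr := hlam.transcendental ⟨{a, b}, he⟩
    have h0 : lam {a, b} ≠ 0 := fun h => htr (by simpa only [h] using isAlgebraic_zero)
    have h4 : lam {a, b} ≠ (4 : ℕ) := fun h => htr (by simpa only [h] using isAlgebraic_natCast 4)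
    have : 1 - c ^ 2 = (lam {a, b} : ℂ) * ((4 : ℕ) - lam {a, b}) / 4 := by
      rw [← hc]
      push_cast
      ring
    rw [this]
    refine div_ne_zero (mul_ne_zero (mod_cast h0) (sub_ne_zero.2 ?_)) (by norm_num)
    exact_mod_cast h4.symm
  have haV : a ∈ G.V := G.edge_sub _ he (by simp)
  have hbV : b ∈ G.V := G.edge_sub _ he (by simp)
  have := (pinnedRealizations_finite hG hlam (a := ⟨a, haV⟩) (b := ⟨b, hbV⟩)
    (by simpa using hab) hcs).to_subtype
  exact Finite.of_surjective _ (pinnedToRealization_surjective (a := ⟨a, haV⟩) (b := ⟨b, hbV⟩)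
    he (α := ![1, 0, 0]) (β := ![c, s, 0]) (by simp) (by simpa [pow_two] using hcs)
    (by simpa using hc) (by simpa using hc0))

end PinnedRealizations

section Sparsity

/-- Every set `X` of at least two vertices spans at most `2 |X| - 3` edges. -/
def Sparse (E : Finset (Finset ℕ)) : Prop :=
  ∀ X : Finset ℕ, 2 ≤ X.card → (E.filter (· ⊆ X)).card + 3 ≤ 2 * X.card

theorem Sparse.mono {E E' : Finset (Finset ℕ)} (hE : Sparse E) (h : E' ⊆ E) : Sparse E' :=
  fun X hX => (Nat.add_le_add_right (Finset.card_le_card (Finset.filter_subset_filter _ h)) 3).trans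
    (hE X hX)

theorem Laman.sparse {G : GeoGraph} (hG : Laman G) : Sparse G.E := by
  obtain ⟨hV, -, hsub⟩ := hG
  intro X hX
  by_cases h2 : 2 ≤ (X ∩ G.V).card
  · have h := hsub ⟨X ∩ G.V, G.E.filter (· ⊆ X),
      fun e he => Finset.subset_inter (Finset.mem_filter.1 he).2
        (G.edge_sub e (Finset.mem_filter.1 he).1),
      fun e he => G.edge_two e (Finset.mem_filter.1 he).1⟩
      ⟨Finset.inter_subset_right, Finset.filter_subset _ _⟩ h2
    have h' := Finset.card_le_card (Finset.inter_subset_left : X ∩ G.V ⊆ X)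
    simp only at h
    omega
  · have : G.E.filter (· ⊆ X) = ∅ := by
      refine Finset.filter_eq_empty_iff.2 fun e he heX => h2 ?_
      rw [← G.edge_two e he]
      exact Finset.card_le_card (Finset.subset_inter heX (G.edge_sub e he))
    rw [this, Finset.card_empty]
    omega

/-- The neighbours of `v` within the edge set `E`. -/
def neighbors (E : Finset (Finset ℕ)) (v : ℕ) : Finset ℕ :=
  (E.sup id).filter fun u => {v, u} ∈ E

theorem mem_neighbors {E : Finset (Finset ℕ)} {v u : ℕ} : u ∈ neighbors E v ↔ {v, u} ∈ E := by
  simp only [neighbors, Finset.mem_filter, Finset.mem_sup, id, and_iff_right_iff_imp]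
  exact fun h => ⟨_, h, by simp⟩

theorem ne_of_mem_neighbors {E : Finset (Finset ℕ)} (hE : ∀ e ∈ E, e.card = 2) {v u : ℕ}
    (h : u ∈ neighbors E v) : u ≠ v := by
  rintro rfl
  simpa using hE _ (mem_neighbors.1 h)

theorem exists_mem_neighbors {E : Finset (Finset ℕ)} (hE : ∀ e ∈ E, e.card = 2) {v : ℕ}
    {e : Finset ℕ} (he : e ∈ E) (hv : v ∈ e) : ∃ u ∈ neighbors E v, e = {v, u} := by
  obtain ⟨x, y, hxy, rfl⟩ := Finset.card_eq_two.1 (hE e he)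
  rcases Finset.mem_insert.1 hv with rfl | hv
  · exact ⟨y, mem_neighbors.2 he, rfl⟩
  · obtain rfl := Finset.mem_singleton.1 hv
    exact ⟨x, mem_neighbors.2 (Finset.pair_comm x v ▸ he), Finset.pair_comm _ _⟩

theorem card_filter_mem_eq_card_neighbors {E : Finset (Finset ℕ)} (hE : ∀ e ∈ E, e.card = 2)
    (v : ℕ) : (E.filter (v ∈ ·)).card = (neighbors E v).card := by
  symm
  refine Finset.card_bij (fun u _ => {v, u}) (fun u hu => ?_) (fun u hu w hw h => ?_) fun e he => ?_
  · simpa using mem_neighbors.1 hu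
  · have hmem : u ∈ ({v, w} : Finset ℕ) := h ▸ (by simp)
    simpa [ne_of_mem_neighbors hE hu] using hmem
  · obtain ⟨he, hv⟩ := Finset.mem_filter.1 he
    obtain ⟨u, hu, rfl⟩ := exists_mem_neighbors hE he hv
    exact ⟨u, hu, rfl⟩

/-- A nonempty sparse graph has a vertex of degree one, two or three. -/
theorem Sparse.exists_card_neighbors {E : Finset (Finset ℕ)} (hE : ∀ e ∈ E, e.card = 2)
    (hs : Sparse E) (hne : E.Nonempty) :
    ∃ v, 1 ≤ (neighbors E v).card ∧ (neighbors E v).card ≤ 3 := by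
  have hsub : ∀ e ∈ E, e ⊆ E.sup id := fun e he => Finset.le_sup (f := id) he
  have hcard := hs (E.sup id) (by
    obtain ⟨e, he⟩ := hne
    exact (hE e he).symm.le.trans (Finset.card_le_card (hsub e he)))
  rw [Finset.filter_true_of_mem hsub] at hcard
  have hsum : ∑ v ∈ E.sup id, (neighbors E v).card = ∑ e ∈ E, 2 := by
    simp only [← card_filter_mem_eq_card_neighbors hE]
    refine (Finset.sum_card_bipartiteAbove_eq_sum_card_bipartiteBelow (· ∈ ·)).trans
      (Finset.sum_congr rfl fun e he => ?_)
    rw [← hE e he]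
    congr 1
    ext v
    simpa [Finset.bipartiteBelow] using fun hv => ⟨e, he, hv⟩
  obtain ⟨v, hv, hlt⟩ : ∃ v ∈ E.sup id, (neighbors E v).card < 4 := by
    refine Finset.exists_lt_of_sum_lt ?_
    rw [hsum, Finset.sum_const, Finset.sum_const, smul_eq_mul, smul_eq_mul]
    omega
  refine ⟨v, ?_, Nat.lt_succ_iff.1 hlt⟩
  obtain ⟨e, he, hve⟩ := Finset.mem_sup.1 hv
  rw [← card_filter_mem_eq_card_neighbors hE]
  exact Finset.card_pos.2 ⟨e, Finset.mem_filter.2 ⟨he, hve⟩⟩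

theorem card_filter_subset_add_le (E : Finset (Finset ℕ)) (X Y : Finset ℕ) :
    (E.filter (· ⊆ X)).card + (E.filter (· ⊆ Y)).card ≤
      (E.filter (· ⊆ X ∪ Y)).card + (E.filter (· ⊆ X ∩ Y)).card := by
  rw [← Finset.card_union_add_card_inter]
  refine Nat.add_le_add (Finset.card_le_card fun e => ?_) (Finset.card_le_card fun e => ?_)
  · simp only [Finset.mem_union, Finset.mem_filter]
    rintro (⟨he, h⟩ | ⟨he, h⟩)
    · exact ⟨he, h.trans Finset.subset_union_left⟩
    · exact ⟨he, h.trans Finset.subset_union_right⟩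
  · simp only [Finset.mem_inter, Finset.mem_filter]
    exact fun ⟨⟨he, hX⟩, _, hY⟩ => ⟨he, Finset.subset_inter hX hY⟩

/-- In a sparse graph three tight sets that pairwise meet either have two of them with tight union,
or tight union altogether. -/
theorem Sparse.exists_tight_union {E : Finset (Finset ℕ)} (hE : ∀ e ∈ E, e.card = 2)
    (hs : Sparse E) {a b c : ℕ} (hab : a ≠ b) {A B C : Finset ℕ}
    (hA : 2 * A.card ≤ (E.filter (· ⊆ A)).card + 3) (hB : 2 * B.card ≤ (E.filter (· ⊆ B)).card + 3)
    (hC : 2 * C.card ≤ (E.filter (· ⊆ C)).card + 3)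
    (hcA : c ∈ A) (hbA : b ∈ A) (hcB : c ∈ B) (haB : a ∈ B) (haC : a ∈ C) (hbC : b ∈ C) :
    ∃ X, (X = A ∪ B ∨ X = A ∪ C ∨ X = B ∪ C ∨ X = A ∪ B ∪ C) ∧
      2 * X.card ≤ (E.filter (· ⊆ X)).card + 3 := by
  have tight_union {X Y : Finset ℕ} (hX : 2 * X.card ≤ (E.filter (· ⊆ X)).card + 3)
      (hY : 2 * Y.card ≤ (E.filter (· ⊆ Y)).card + 3) (h : 2 ≤ (X ∩ Y).card) :
      2 * (X ∪ Y).card ≤ (E.filter (· ⊆ X ∪ Y)).card + 3 := by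
    have := hs _ h
    have := card_filter_subset_add_le E X Y
    have := Finset.card_union_add_card_inter X Y
    omega
  by_cases hAB : 2 ≤ (A ∩ B).card
  · exact ⟨_, Or.inl rfl, tight_union hA hB hAB⟩
  by_cases hAC : 2 ≤ (A ∩ C).card
  · exact ⟨_, Or.inr (Or.inl rfl), tight_union hA hC hAC⟩
  by_cases hBC : 2 ≤ (B ∩ C).card
  · exact ⟨_, Or.inr (Or.inr (Or.inl rfl)), tight_union hB hC hBC⟩
  refine ⟨_, Or.inr (Or.inr (Or.inr rfl)), ?_⟩
  have disj {X Y : Finset ℕ} (h : ¬ 2 ≤ (X ∩ Y).card) :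
      Disjoint (E.filter (· ⊆ X)) (E.filter (· ⊆ Y)) := by
    refine Finset.disjoint_left.2 fun e hX hY => h ?_
    rw [Finset.mem_filter] at hX hY
    rw [← hE e hX.1]
    exact Finset.card_le_card (Finset.subset_inter hX.2 hY.2)
  have hle : (E.filter (· ⊆ A)).card + (E.filter (· ⊆ B)).card + (E.filter (· ⊆ C)).card ≤
      (E.filter (· ⊆ A ∪ B ∪ C)).card := by
    rw [← Finset.card_union_of_disjoint (disj hAB), ← Finset.card_union_of_disjoint
      (Finset.disjoint_union_left.2 ⟨disj hAC, disj hBC⟩)]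
    refine Finset.card_le_card fun e => ?_
    simp only [Finset.mem_union, Finset.mem_filter]
    rintro ((⟨he, h⟩ | ⟨he, h⟩) | ⟨he, h⟩) <;> refine ⟨he, h.trans ?_⟩
    · exact Finset.subset_union_left.trans Finset.subset_union_left
    · exact Finset.subset_union_right.trans Finset.subset_union_left
    · exact Finset.subset_union_right
  have h1 := Finset.card_union_add_card_inter A B
  have h2 := Finset.card_union_add_card_inter (A ∪ B) C
  have h3 : 1 ≤ (A ∩ B).card := Finset.card_pos.2 ⟨c, Finset.mem_inter.2 ⟨hcA, hcB⟩⟩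
  have h4 : 2 ≤ ((A ∪ B) ∩ C).card :=
    Finset.one_lt_card.2 ⟨a, by simp [haB, haC], b, by simp [hbA, hbC], hab⟩
  omega

/-- A vertex of degree three in a sparse graph can be removed and replaced by an edge between two
of its neighbours, keeping sparsity. -/
theorem Sparse.exists_insert_pair {E : Finset (Finset ℕ)} (hE : ∀ e ∈ E, e.card = 2)
    (hs : Sparse E) {v a b c : ℕ} (hab : a ≠ b) (hac : a ≠ c) (hbc : b ≠ c)
    (hN : neighbors E v = {a, b, c}) :
    ∃ x y z, x ≠ y ∧ ({x, y, z} : Finset ℕ) = {a, b, c} ∧ {x, y} ∉ E ∧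
      Sparse (insert {x, y} (E.filter (v ∉ ·))) := by
  have hva : v ≠ a := (ne_of_mem_neighbors hE (v := v) (u := a) (by simp [hN])).symm
  have hvb : v ≠ b := (ne_of_mem_neighbors hE (v := v) (u := b) (by simp [hN])).symm
  have hvc : v ≠ c := (ne_of_mem_neighbors hE (v := v) (u := c) (by simp [hN])).symm
  by_contra! hcon
  set E' := E.filter (v ∉ ·) with hE'
  have hs' : Sparse E' := hs.mono (Finset.filter_subset _ _)
  have tight {x y z : ℕ} (hxy : x ≠ y) (hxyz : ({x, y, z} : Finset ℕ) = {a, b, c}) :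
      ∃ X, x ∈ X ∧ y ∈ X ∧ v ∉ X ∧ 2 * X.card ≤ (E'.filter (· ⊆ X)).card + 3 := by
    have hx : v ≠ x := by
      have : x ∈ ({a, b, c} : Finset ℕ) := hxyz ▸ (by simp)
      rintro rfl
      simp [hva, hvb, hvc] at this
    have hy : v ≠ y := by
      have : y ∈ ({a, b, c} : Finset ℕ) := hxyz ▸ (by simp)
      rintro rfl
      simp [hva, hvb, hvc] at this
    by_cases hmem : {x, y} ∈ E
    · refine ⟨{x, y}, by simp, by simp, by simp [hx, hy], ?_⟩
      have : 0 < (E'.filter (· ⊆ {x, y})).card :=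
        Finset.card_pos.2 ⟨{x, y}, by simp [hE', hmem, hx, hy]⟩
      rw [Finset.card_pair hxy]
      omega
    · have h := hcon x y z hxy hxyz hmem
      rw [Sparse] at h
      push Not at h
      obtain ⟨X, hX, hlt⟩ := h
      have hle := hs' X hX
      rw [Finset.filter_insert] at hlt
      split_ifs at hlt with hsub
      · have hins := Finset.card_insert_le {x, y} (E'.filter (· ⊆ X))
        rw [Finset.insert_subset_iff, Finset.singleton_subset_iff] at hsub
        refine ⟨X, hsub.1, hsub.2, fun hv => ?_, by omega⟩
        have hsub' : E'.filter (· ⊆ X) ⊆ E'.filter (· ⊆ X.erase v) := fun e he => by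
          rw [Finset.mem_filter] at he ⊢
          exact ⟨he.1, Finset.subset_erase.2 ⟨he.2, (Finset.mem_filter.1 he.1).2⟩⟩
        have h2 := hs' (X.erase v) (Finset.one_lt_card.2
          ⟨x, by simp [hsub.1, hx.symm], y, by simp [hsub.2, hy.symm], hxy⟩)
        have h3 := Finset.card_le_card hsub'
        have h4 := Finset.card_erase_add_one hv
        omega
      · omega
  have not_tight {X : Finset ℕ} (ha : a ∈ X) (hb : b ∈ X) (hc : c ∈ X) (hv : v ∉ X) :
      ¬ 2 * X.card ≤ (E'.filter (· ⊆ X)).card + 3 := by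
    intro ht
    have hle := hs (insert v X) (Finset.one_lt_card.2
      ⟨v, by simp, a, by simp [ha], hva⟩)
    have hsub : E'.filter (· ⊆ X) ∪ E.filter (v ∈ ·) ⊆ E.filter (· ⊆ insert v X) := by
      intro e he
      rw [Finset.mem_filter]
      rcases Finset.mem_union.1 he with he | he
      · exact ⟨(Finset.mem_filter.1 (Finset.mem_filter.1 he).1).1,
          (Finset.mem_filter.1 he).2.trans (Finset.subset_insert _ _)⟩
      · obtain ⟨he, hve⟩ := Finset.mem_filter.1 he
        refine ⟨he, fun w hw => ?_⟩
        by_cases hwv : w = v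
        · simp [hwv]
        obtain ⟨u, this, rfl⟩ := exists_mem_neighbors hE he hve
        obtain rfl : w = u := by simpa [hwv] using hw
        rw [hN] at this
        simp only [Finset.mem_insert, Finset.mem_singleton] at this
        rcases this with rfl | rfl | rfl <;> simp [*]
    have hdisj : Disjoint (E'.filter (· ⊆ X)) (E.filter (v ∈ ·)) :=
      Finset.disjoint_left.2 fun e he hve =>
        (Finset.mem_filter.1 (Finset.mem_filter.1 he).1).2 (Finset.mem_filter.1 hve).2
    have h := Finset.card_le_card hsub
    rw [Finset.card_union_of_disjoint hdisj, card_filter_mem_eq_card_neighbors hE, hN,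
      Finset.card_eq_three.2 ⟨a, b, c, hab, hac, hbc, rfl⟩] at h
    rw [Finset.card_insert_of_notMem hv] at hle
    omega
  obtain ⟨A, hbA, hcA, hvA, hA⟩ := tight hbc (z := a) (by grind)
  obtain ⟨B, haB, hcB, hvB, hB⟩ := tight hac (z := b) (by grind)
  obtain ⟨C, haC, hbC, hvC, hC⟩ := tight hab (z := c) rfl
  obtain ⟨X, hX, hXt⟩ := hs'.exists_tight_union (fun e he => hE e (Finset.filter_subset _ _ he))
    hab hA hB hC hcA hbA hcB haB haC hbC
  refine not_tight ?_ ?_ ?_ ?_ hXt <;> rcases hX with rfl | rfl | rfl | rfl <;>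
    simp only [Finset.mem_union] <;> tauto

end Sparsity

section Stress

open Matrix

/-- The configuration `p` of vectors carries no nonzero spherical equilibrium stress supported on
`E`. -/
def StressFree (S : Finset ℕ) (E : Finset (Finset ℕ)) (p : ℕ → Fin 3 → ℝ) : Prop :=
  ∀ ω : Finset ℕ → ℝ, (∀ e, e ∉ E → ω e = 0) →
    (∀ u ∈ S, ∑ v ∈ S, ω {u, v} • crossProduct (p u) (p v) = 0) → ω = 0

/-- The row of the spherical rigidity matrix belonging to the edge `e`. -/
def rigidityRow (S : Finset ℕ) (p : ℕ → Fin 3 → ℝ) (e : Finset ℕ) (u : S) : Fin 3 → ℝ :=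
  ∑ v ∈ S, if {u.1, v} = e then crossProduct (p u) (p v) else 0

theorem stressFree_iff_linearIndependent {S : Finset ℕ} {E : Finset (Finset ℕ)}
    {p : ℕ → Fin 3 → ℝ} :
    StressFree S E p ↔ LinearIndependent ℝ fun e : E => rigidityRow S p e.1 := by
  have sum_eq (ω : Finset ℕ → ℝ) (hω : ∀ e, e ∉ E → ω e = 0) (u : S) :
      (∑ e : E, ω e.1 • rigidityRow S p e.1) u =
        ∑ v ∈ S, ω {u.1, v} • crossProduct (p u) (p v) := by
    rw [Finset.sum_apply, Finset.sum_coe_sort E fun e => (ω e • rigidityRow S p e) u]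
    simp only [Pi.smul_apply, rigidityRow, Finset.smul_sum, smul_ite, smul_zero]
    rw [Finset.sum_comm]
    refine Finset.sum_congr rfl fun v _ => ?_
    rw [Finset.sum_ite_eq]
    split_ifs with h
    · rfl
    · rw [hω _ h, zero_smul]
  rw [Fintype.linearIndependent_iff]
  constructor
  · intro h g hg e
    classical
    let ω : Finset ℕ → ℝ := fun e => if he : e ∈ E then g ⟨e, he⟩ else 0
    have hω : ∀ e, e ∉ E → ω e = 0 := fun e he => dif_neg he
    have hωg : ∀ e : E, ω e.1 = g e := fun e => dif_pos e.2
    rw [← hωg, h ω hω fun u hu => ?_, Pi.zero_apply]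
    rw [← sum_eq ω hω ⟨u, hu⟩]
    simp only [hωg, hg, Pi.zero_apply]
  · intro h ω hω heq
    have := h (fun e => ω e.1) (funext fun u => (sum_eq ω hω u).trans (heq u u.2))
    ext e
    by_cases he : e ∈ E
    · exact this ⟨e, he⟩
    · exact hω e he

/-- A stress-free configuration can be perturbed so that three given vectors become independent. -/
theorem StressFree.exists_det_ne_zero {S : Finset ℕ} {E : Finset (Finset ℕ)} {p : ℕ → Fin 3 → ℝ}
    (hp : StressFree S E p) {a b c : ℕ} (hab : a ≠ b) (hac : a ≠ c) (hbc : b ≠ c) :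
    ∃ p', StressFree S E p' ∧ (Matrix.of ![p' a, p' b, p' c]).det ≠ 0 := by
  let q : ℕ → Fin 3 → ℝ := fun w =>
    if w = a then Pi.single 0 1 else if w = b then Pi.single 1 1 else
      if w = c then Pi.single 2 1 else 0
  let P : Matrix (Fin 3) (Fin 3) ℝ := -Matrix.of ![p a, p b, p c]
  have hopen : {t : ℝ | StressFree S E (p + t • q)} ∈ nhds (0 : ℝ) := by
    simp only [stressFree_iff_linearIndependent]
    have hcont : Continuous fun (t : ℝ) (e : E) => rigidityRow S (p + t • q) e.1 := by
      refine continuous_pi fun e => continuous_pi fun u => ?_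
      refine continuous_finsetSum _ fun v _ => ?_
      split_ifs
      · refine continuous_pi fun i => ?_
        fin_cases i <;> simp only [cross_apply] <;> simp <;> fun_prop
      · exact continuous_const
    refine hcont.continuousAt.eventually (LinearIndependent.eventually ?_)
    simpa [stressFree_iff_linearIndependent] using hp
  have hroots : {t : ℝ | P.charpoly.IsRoot t}.Finite :=
    Polynomial.finite_setOfPred_isRoot P.charpoly_monic.ne_zero
  obtain ⟨t, ht, htP⟩ := ((infinite_of_mem_nhds (0 : ℝ) hopen).sdiff hroots).nonempty
  refine ⟨p + t • q, ht, ?_⟩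
  have hdet : P.charpoly.eval t =
      (Matrix.of ![(p + t • q) a, (p + t • q) b, (p + t • q) c]).det := by
    rw [Matrix.eval_charpoly]
    congr 1
    ext i j
    fin_cases i <;> fin_cases j <;> simp [P, q, hab.symm, hac.symm, hbc.symm, add_comm]
  rwa [← hdet]

theorem sum_eq_sum_neighbors {S : Finset ℕ} {E : Finset (Finset ℕ)} (hS : ∀ e ∈ E, e ⊆ S)
    {ω : Finset ℕ → ℝ} (hω : ∀ e, e ∉ E → ω e = 0) (v : ℕ) (f : ℕ → Fin 3 → ℝ) {N : Finset ℕ}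
    (hN : neighbors E v ⊆ N) : ∑ u ∈ S, ω {v, u} • f u = ∑ u ∈ N, ω {v, u} • f u := by
  have hzero {u : ℕ} (hu : u ∉ neighbors E v) : ω {v, u} • f u = 0 := by
    rw [hω _ (fun h => hu (mem_neighbors.2 h)), zero_smul]
  have hNS : neighbors E v ⊆ S := fun u hu => hS _ (mem_neighbors.1 hu) (by simp)
  rw [← Finset.sum_subset hN fun u _ => hzero, ← Finset.sum_subset hNS fun u _ => hzero]

/-- Adding a vertex of degree at most two to a stress-free graph. -/
theorem StressFree.exists_of_neighbors_subset_pair {S : Finset ℕ} {E : Finset (Finset ℕ)}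
    (hE : ∀ e ∈ E, e.card = 2) (hS : ∀ e ∈ E, e ⊆ S) {v a b : ℕ} (hvS : v ∈ S) (hab : a ≠ b)
    (hav : a ≠ v) (hbv : b ≠ v) (hN : neighbors E v ⊆ {a, b})
    (h : ∃ p, StressFree S (E.filter (v ∉ ·)) p) : ∃ p, StressFree S E p := by
  obtain ⟨p₀, hp₀⟩ := h
  obtain ⟨p, hp, hdet⟩ := hp₀.exists_det_ne_zero hab hav hbv
  refine ⟨p, fun ω hω heq => hp ω (fun e he => ?_) heq⟩
  have hv := heq v hvS
  rw [sum_eq_sum_neighbors hS hω v (fun u => crossProduct (p v) (p u)) hN,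
    Finset.sum_pair hab] at hv
  have h0 := congrFun hv 0
  have h1 := congrFun hv 1
  have h2 := congrFun hv 2
  simp [cross_apply] at h0 h1 h2
  simp only [Matrix.det_fin_three, Matrix.of_apply, Matrix.cons_val] at hdet
  have ha : ω {v, a} = 0 := by
    refine (mul_eq_zero.1 ?_).resolve_right hdet
    linear_combination p b 0 * h0 + p b 1 * h1 + p b 2 * h2
  have hb : ω {v, b} = 0 := by
    refine (mul_eq_zero.1 ?_).resolve_right hdet
    linear_combination (-p a 0) * h0 - p a 1 * h1 - p a 2 * h2
  by_cases heE : e ∈ E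
  · have hve : v ∈ e := by simpa [heE] using he
    obtain ⟨u, hu, rfl⟩ := exists_mem_neighbors hE heE hve
    have := hN hu
    rw [Finset.mem_insert, Finset.mem_singleton] at this
    rcases this with rfl | rfl <;> assumption
  · exact hω e heE

/-- Reversing the replacement of a vertex of degree three by an edge between two of its
neighbours. -/
theorem StressFree.exists_of_neighbors_eq_triple {S : Finset ℕ} {E : Finset (Finset ℕ)}
    (hE : ∀ e ∈ E, e.card = 2) (hS : ∀ e ∈ E, e ⊆ S) {v x y z : ℕ} (hxy : x ≠ y) (hxz : x ≠ z)
    (hyz : y ≠ z) (hN : neighbors E v = {x, y, z}) (hxyE : {x, y} ∉ E)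
    (h : ∃ p, StressFree S (insert {x, y} (E.filter (v ∉ ·))) p) : ∃ p, StressFree S E p := by
  obtain ⟨p₀, hp₀⟩ := h
  obtain ⟨p, hp, hdet⟩ := hp₀.exists_det_ne_zero hxy hxz hyz
  have hx : {v, x} ∈ E := mem_neighbors.1 (by simp [hN])
  have hy : {v, y} ∈ E := mem_neighbors.1 (by simp [hN])
  have hxv : x ≠ v := ne_of_mem_neighbors hE (mem_neighbors.2 hx)
  have hyv : y ≠ v := ne_of_mem_neighbors hE (mem_neighbors.2 hy)
  have hzv : z ≠ v := ne_of_mem_neighbors hE (v := v) (u := z) (by simp [hN])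
  have hvS : v ∈ S := hS _ hx (by simp)
  have hxS : x ∈ S := hS _ hx (by simp)
  have hyS : y ∈ S := hS _ hy (by simp)
  let p' := Function.update p v (p x + p y)
  have hp'v : p' v = p x + p y := Function.update_self ..
  have hp' {u : ℕ} (hu : u ≠ v) : p' u = p u := Function.update_of_ne hu ..
  refine ⟨p', fun ω hω heq => ?_⟩
  have hstar {e : Finset ℕ} (hve : v ∈ e) (hex : e ≠ {v, x}) (hey : e ≠ {v, y})
      (hez : e ≠ {v, z}) : ω e = 0 := by
    refine hω e fun he => ?_
    obtain ⟨u, hu, rfl⟩ := exists_mem_neighbors hE he hve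
    rw [hN] at hu
    simp only [Finset.mem_insert, Finset.mem_singleton] at hu
    rcases hu with rfl | rfl | rfl <;> contradiction
  obtain ⟨hz0, hμ⟩ : ω {v, z} = 0 ∧ ω {v, x} = ω {v, y} := by
    have hv := heq v hvS
    rw [sum_eq_sum_neighbors hS hω v (fun u => crossProduct (p' v) (p' u)) hN.subset,
      Finset.sum_insert (by simp [hxy, hxz]), Finset.sum_pair hyz, hp'v, hp' hxv, hp' hyv,
      hp' hzv] at hv
    have h0 := congrFun hv 0
    have h1 := congrFun hv 1
    have h2 := congrFun hv 2
    simp [cross_apply] at h0 h1 h2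
    simp only [Matrix.det_fin_three, Matrix.of_apply, Matrix.cons_val] at hdet
    constructor
    · refine (mul_eq_zero.1 ?_).resolve_right hdet
      linear_combination (-p y 0) * h0 - p y 1 * h1 - p y 2 * h2
    · refine sub_eq_zero.1 ((mul_eq_zero.1 ?_).resolve_right hdet)
      linear_combination (-p z 0) * h0 - p z 1 * h1 - p z 2 * h2
  set μ := ω {v, y} with hμy
  let ω' : Finset ℕ → ℝ := fun e => (if v ∈ e then 0 else ω e) + if e = {x, y} then μ else 0
  have hω'0 : ω' = 0 := by
    refine hp ω' (fun e he => ?_) fun u hu => ?_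
    · simp only [Finset.mem_insert, Finset.mem_filter, not_or, not_and, not_not] at he
      simp only [ω', if_neg he.1, add_zero, ite_eq_left_iff]
      exact fun hve => hω e fun heE => hve (he.2 heE)
    · have hxyv : ({x, y} : Finset ℕ) ≠ {u, v} := fun h => by
        have : v ∈ ({x, y} : Finset ℕ) := h ▸ (by simp)
        simp [hxv.symm, hyv.symm] at this
      by_cases huv : u = v
      · refine Finset.sum_eq_zero fun w _ => ?_
        have : ({u, w} : Finset ℕ) ≠ {x, y} := fun h => by
          have : v ∈ ({x, y} : Finset ℕ) := h ▸ (by simp [huv])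
          simp [hxv.symm, hyv.symm] at this
        simp [ω', huv] at this ⊢
        simp [this]
      have hu_eq := heq u hu
      rw [← Finset.add_sum_erase S _ hvS, hp'v, hp' huv] at hu_eq
      have key : ∑ w ∈ S.erase v, (if ({u, w} : Finset ℕ) = {x, y} then μ else 0) •
          crossProduct (p u) (p w) = ω {u, v} • crossProduct (p u) (p x + p y) := by
        simp only [ite_smul, zero_smul]
        by_cases hux : u = x
        · subst hux
          have hiff (w : ℕ) : ({u, w} : Finset ℕ) = {u, y} ↔ y = w := by
            refine ⟨fun h => ?_, fun h => h ▸ rfl⟩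
            have : y ∈ ({u, w} : Finset ℕ) := h ▸ (by simp)
            simpa [hxy.symm] using this
          simp only [hiff]
          rw [Finset.sum_ite_eq, if_pos (by simp [hyv, hyS]), map_add, cross_self, zero_add,
            Finset.pair_comm, hμ]
        by_cases huy : u = y
        · subst huy
          have hiff (w : ℕ) : ({u, w} : Finset ℕ) = {x, u} ↔ x = w := by
            refine ⟨fun h => ?_, fun h => h ▸ Finset.pair_comm _ _⟩
            have : x ∈ ({u, w} : Finset ℕ) := h ▸ (by simp)
            simpa [hxy] using this
          simp only [hiff]
          rw [Finset.sum_ite_eq, if_pos (by simp [hxv, hxS]), map_add, cross_self, add_zero,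
            Finset.pair_comm]
        · have h0 : ω {u, v} = 0 := by
            by_cases huz : u = z
            · rw [huz, Finset.pair_comm, hz0]
            · refine hω _ fun h => ?_
              rw [Finset.pair_comm, ← mem_neighbors, hN] at h
              simp [hux, huy, huz] at h
          rw [h0, zero_smul]
          refine Finset.sum_eq_zero fun w _ => if_neg fun h => ?_
          have : u ∈ ({x, y} : Finset ℕ) := h ▸ (by simp)
          simp [hux, huy] at this
      have hv0 : ω' {u, v} = 0 := by simp [ω', hxyv.symm]
      rw [← Finset.add_sum_erase S _ hvS, hv0, zero_smul, zero_add, ← hu_eq, ← key, add_comm,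
        ← Finset.sum_add_distrib]
      refine Finset.sum_congr rfl fun w hw => ?_
      have hwv : w ≠ v := Finset.ne_of_mem_erase hw
      rw [hp' hwv, ← add_smul]
      simp [ω', Ne.symm huv, hwv.symm]
  have hμ0 : μ = 0 := by
    simpa [ω', hxv.symm, hyv.symm, hω _ hxyE] using congrFun hω'0 {x, y}
  ext e
  by_cases hve : v ∈ e
  · by_cases hex : e = {v, x}
    · rw [hex, hμ, hμ0, Pi.zero_apply]
    by_cases hey : e = {v, y}
    · rw [hey, ← hμy, hμ0, Pi.zero_apply]
    by_cases hez : e = {v, z}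
    · rw [hez, hz0, Pi.zero_apply]
    exact hstar hve hex hey hez
  · simpa [ω', hve, hμ0] using congrFun hω'0 e

/-- Every sparse graph has a stress-free spherical configuration. -/
theorem Sparse.exists_stressFree {S : Finset ℕ} {E : Finset (Finset ℕ)}
    (hE : ∀ e ∈ E, e.card = 2) (hS : ∀ e ∈ E, e ⊆ S) (hs : Sparse E) :
    ∃ p, StressFree S E p := by
  induction hn : E.card using Nat.strong_induction_on generalizing E with
  | _ n ih =>
    subst hn
    rcases E.eq_empty_or_nonempty with rfl | hne
    · exact ⟨0, fun ω hω _ => funext fun e => hω e (Finset.notMem_empty e)⟩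
    obtain ⟨v, hv1, hv3⟩ := hs.exists_card_neighbors hE hne
    obtain ⟨a, ha⟩ := Finset.card_pos.1 hv1
    have hvS : v ∈ S := hS _ (mem_neighbors.1 ha) (by simp)
    have hcard : (E.filter (v ∉ ·)).card + (neighbors E v).card = E.card := by
      rw [← card_filter_mem_eq_card_neighbors hE, add_comm]
      exact Finset.card_filter_add_card_filter_not _
    have low {a b : ℕ} (hab : a ≠ b) (hav : a ≠ v) (hbv : b ≠ v) (hN : neighbors E v ⊆ {a, b}) :
        ∃ p, StressFree S E p :=
      StressFree.exists_of_neighbors_subset_pair hE hS hvS hab hav hbv hN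
        (ih _ (by omega) (fun e he => hE e (Finset.filter_subset _ _ he))
          (fun e he => hS e (Finset.filter_subset _ _ he)) (hs.mono (Finset.filter_subset _ _)) rfl)
    obtain h | h | h : (neighbors E v).card = 1 ∨ (neighbors E v).card = 2 ∨
      (neighbors E v).card = 3 := by omega
    · obtain ⟨a, hN⟩ := Finset.card_eq_one.1 h
      have hav := ne_of_mem_neighbors hE (v := v) (u := a) (by simp [hN])
      exact low (a := a) (b := a + v + 1) (by omega) hav (by omega) (by simp [hN])
    · obtain ⟨a, b, hab, hN⟩ := Finset.card_eq_two.1 h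
      exact low hab (ne_of_mem_neighbors hE (v := v) (u := a) (by simp [hN]))
        (ne_of_mem_neighbors hE (v := v) (u := b) (by simp [hN])) hN.subset
    · obtain ⟨a, b, c, hab, hac, hbc, hN⟩ := Finset.card_eq_three.1 h
      obtain ⟨x, y, z, hxy, hxyz, hxyE, hs'⟩ := hs.exists_insert_pair hE hab hac hbc hN
      have hN' : neighbors E v = {x, y, z} := hN.trans hxyz.symm
      rw [hN'] at h
      have hxz : x ≠ z := by
        rintro rfl
        have := Finset.card_le_two (a := y) (b := x)
        simp at h
        omega
      have hyz : y ≠ z := by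
        rintro rfl
        have := Finset.card_le_two (a := x) (b := y)
        simp at h
        omega
      refine StressFree.exists_of_neighbors_eq_triple hE hS hxy hxz hyz hN' hxyE
        (ih _ ?_ (fun e he => ?_) (fun e he => ?_) hs' rfl)
      · have := Finset.card_insert_le {x, y} (E.filter (v ∉ ·))
        rw [hN', h] at hcard
        omega
      · rcases Finset.mem_insert.1 he with rfl | he
        · exact Finset.card_pair hxy
        · exact hE e (Finset.filter_subset _ _ he)
      · rcases Finset.mem_insert.1 he with rfl | he
        · have hmem {w : ℕ} (hw : w ∈ neighbors E v) : w ∈ S :=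
            hS _ (mem_neighbors.1 hw) (by simp)
          exact Finset.insert_subset (hmem (by simp [hN']))
            (Finset.singleton_subset_iff.2 (hmem (by simp [hN'])))
        · exact hS e (Finset.filter_subset _ _ he)

end Stress

section RealRealizations

open Matrix Topology

theorem StressFree.exists_ne_zero {S : Finset ℕ} {E : Finset (Finset ℕ)} {p : ℕ → Fin 3 → ℝ}
    (hp : StressFree S E p) : ∃ q, StressFree S E q ∧ ∀ u, q u ≠ 0 := by
  classical
  have hne : ∀ u v, ({u, v} : Finset ℕ) ∈ E → p u ≠ 0 := by
    intro u v huv hu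
    have h := hp (fun e => if e = {u, v} then 1 else 0)
      (fun e he => if_neg fun h => he (by rwa [h])) fun a _ => Finset.sum_eq_zero fun b _ => by
        by_cases hab : ({a, b} : Finset ℕ) = {u, v}
        · have hmem : u ∈ ({a, b} : Finset ℕ) := by simp [hab]
          simp only [Finset.mem_insert, Finset.mem_singleton] at hmem
          rcases hmem with rfl | rfl <;> simp [hu]
        · simp [hab]
    simpa using congrFun h {u, v}
  refine ⟨fun u => if p u = 0 then Pi.single 0 1 else p u, fun ω hω h => hp ω hω fun u hu => ?_,
    fun u => ?_⟩
  · rw [← h u hu]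
    refine Finset.sum_congr rfl fun v _ => ?_
    by_cases huv : ({u, v} : Finset ℕ) ∈ E
    · simp [hne u v huv, hne v u (Finset.pair_comm u v ▸ huv)]
    · simp [hω _ huv]
  · by_cases h : p u = 0
    · intro h0
      simp [h] at h0
    · simp [h]

/-- The sum of the scalar products of the ordered pairs of points spanning `e`. -/
def gramEntry {S : Finset ℕ} (x : S × Fin 3 → ℝ) (e : Finset ℕ) : ℝ :=
  ∑ u : S, ∑ v : S, if ({u.1, v.1} : Finset ℕ) = e then ∑ i, x (u, i) * x (v, i) else 0

theorem gramEntry_singleton {S : Finset ℕ} (x : S × Fin 3 → ℝ) (u : S) :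
    gramEntry x {u.1} = ∑ i, x (u, i) ^ 2 := by
  unfold gramEntry
  rw [Finset.sum_eq_single u, Finset.sum_eq_single u]
  · simp [sq]
  · intro v _ hv
    rw [if_neg]
    intro h
    have : v.1 ∈ ({u.1} : Finset ℕ) := h ▸ by simp
    exact hv (Subtype.ext (by simpa using this))
  · simp
  · intro v _ hv
    refine Finset.sum_eq_zero fun w _ => ?_
    rw [if_neg]
    intro h
    have : v.1 ∈ ({u.1} : Finset ℕ) := h ▸ by simp
    exact hv (Subtype.ext (by simpa using this))
  · simp

theorem gramEntry_pair {S : Finset ℕ} (x : S × Fin 3 → ℝ) {u v : S} (huv : u ≠ v) :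
    gramEntry x {u.1, v.1} = 2 * ∑ i, x (u, i) * x (v, i) := by
  have key : ∀ a b : S, ({a.1, b.1} : Finset ℕ) = {u.1, v.1} ↔
      (a = u ∧ b = v) ∨ (a = v ∧ b = u) := by
    intro a b
    have := Subtype.coe_injective.ne huv
    simp only [Subtype.ext_iff, Finset.ext_iff, Finset.mem_insert, Finset.mem_singleton]
    constructor
    · intro h
      have h1 := h a.1
      have h2 := h b.1
      have h3 := h u.1
      have h4 := h v.1
      grind
    · grind
  unfold gramEntry
  have : ∀ a b : S, (if ({a.1, b.1} : Finset ℕ) = {u.1, v.1}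
      then ∑ i, x (a, i) * x (b, i) else 0) =
      (if a = u then if b = v then ∑ i, x (a, i) * x (b, i) else 0 else 0) +
      (if a = v then if b = u then ∑ i, x (a, i) * x (b, i) else 0 else 0) := by
    intro a b
    simp only [key]
    grind
  simp only [this, Finset.sum_add_distrib, Finset.sum_ite_irrel, Finset.sum_ite_eq',
    Finset.mem_univ, if_true, Finset.sum_const_zero]
  rw [two_mul]
  simp [mul_comm]

/-- The derivative of `gramEntry` with respect to the points. -/
def gramEntryDeriv {S : Finset ℕ} (x : S × Fin 3 → ℝ) (e : Finset ℕ) :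
    (S × Fin 3 → ℝ) →L[ℝ] ℝ :=
  ∑ u : S, ∑ v : S, if ({u.1, v.1} : Finset ℕ) = e then
    ∑ i, (x (u, i) • ContinuousLinearMap.proj (v, i) +
      x (v, i) • ContinuousLinearMap.proj (u, i)) else 0

theorem hasStrictFDerivAt_gramEntry {S : Finset ℕ} (x : S × Fin 3 → ℝ) (e : Finset ℕ) :
    HasStrictFDerivAt (fun y => gramEntry y e) (gramEntryDeriv x e) x := by
  unfold gramEntry gramEntryDeriv
  refine .fun_sum fun u _ => .fun_sum fun v _ => ?_
  split_ifs
  · exact .fun_sum fun i _ => (hasStrictFDerivAt_apply (u, i) x).mul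
      (hasStrictFDerivAt_apply (v, i) x)
  · exact hasStrictFDerivAt_const 0 x

/-- The edges together with the singletons of the vertices. -/
abbrev gramIndex (S : Finset ℕ) (E : Finset (Finset ℕ)) : Finset (Finset ℕ) :=
  E ∪ S.image fun u => {u}

theorem sum_mul_gramEntryDeriv_single {S : Finset ℕ} {F : Finset (Finset ℕ)} {ω : Finset ℕ → ℝ}
    (hω : ∀ e, e ∉ F → ω e = 0) (x : S × Fin 3 → ℝ) (w : S) (i : Fin 3) :
    ∑ e : F, gramEntryDeriv x e.1 (Pi.single (w, i) 1) * ω e.1 =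
      2 * ∑ v : S, ω {w.1, v.1} * x (v, i) := by
  have h1 : ∀ u v : S, ∑ e : F, (if ({u.1, v.1} : Finset ℕ) = e.1 then
      (∑ j, (x (u, j) * (Pi.single (w, i) 1 : S × Fin 3 → ℝ) (v, j) +
      x (v, j) * (Pi.single (w, i) 1 : S × Fin 3 → ℝ) (u, j))) else 0) * ω e.1 =
      ω {u.1, v.1} * ((if v = w then x (u, i) else 0) + if u = w then x (v, i) else 0) := by
    intro u v
    rw [Finset.sum_coe_sort F fun e => (if ({u.1, v.1} : Finset ℕ) = e then
      (∑ j, (x (u, j) * (Pi.single (w, i) 1 : S × Fin 3 → ℝ) (v, j) +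
      x (v, j) * (Pi.single (w, i) 1 : S × Fin 3 → ℝ) (u, j))) else 0) * ω e]
    simp only [ite_mul, zero_mul, Finset.sum_ite_eq]
    have h2 : ∀ a b : S, ∑ j, x (a, j) * (Pi.single (w, i) 1 : S × Fin 3 → ℝ) (b, j) =
        if b = w then x (a, i) else 0 := by
      intro a b
      by_cases hb : b = w
      · subst hb
        rw [Finset.sum_eq_single i] <;> simp +contextual
      · simp [hb]
    by_cases h : ({u.1, v.1} : Finset ℕ) ∈ F
    · rw [if_pos h, Finset.sum_add_distrib, h2, h2, mul_comm]
    · rw [if_neg h, hω _ h, zero_mul]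
  calc _ = ∑ u : S, ∑ v : S, ω {u.1, v.1} *
        ((if v = w then x (u, i) else 0) + if u = w then x (v, i) else 0) := by
        simp only [← h1]
        rw [Finset.sum_congr rfl fun u _ => Finset.sum_comm, Finset.sum_comm]
        refine Finset.sum_congr rfl fun e _ => ?_
        simp only [← Finset.sum_mul]
        congr 1
        simp only [gramEntryDeriv, _root_.sum_apply]
        refine Finset.sum_congr rfl fun u _ => Finset.sum_congr rfl fun v _ => ?_
        split_ifs <;> simp
    _ = _ := by
        simp only [mul_add, Finset.sum_add_distrib, mul_ite, mul_zero, Finset.sum_ite_irrel,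
          Finset.sum_ite_eq', Finset.mem_univ, if_true, Finset.sum_const_zero, two_mul]
        congr 1
        exact Finset.sum_congr rfl fun v _ => by rw [Finset.pair_comm]

theorem range_gramEntry_mem_nhds {S : Finset ℕ} {E : Finset (Finset ℕ)} {p : ℕ → Fin 3 → ℝ}
    (hp : StressFree S E p) (h0 : ∀ u, p u ≠ 0) :
    Set.range (fun (x : S × Fin 3 → ℝ) (e : gramIndex S E) => gramEntry x e.1) ∈
      𝓝 (fun e : gramIndex S E => gramEntry (fun k : S × Fin 3 => p k.1 k.2) e.1) := by
  set x : S × Fin 3 → ℝ := fun k => p k.1 k.2 with hx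
  have hd : HasStrictFDerivAt (fun (x : S × Fin 3 → ℝ) (e : gramIndex S E) => gramEntry x e.1)
      (ContinuousLinearMap.pi fun e => gramEntryDeriv x e.1) x :=
    hasStrictFDerivAt_pi.2 fun e => hasStrictFDerivAt_gramEntry x e.1
  have hsurj :
      (ContinuousLinearMap.pi fun e : gramIndex S E => gramEntryDeriv x e.1).range = ⊤ := by
    by_contra hlt
    obtain ⟨f, hf, hle⟩ := Submodule.exists_le_ker_of_lt_top _ (lt_top_iff_ne_top.2 hlt)
    apply hf
    let ω : Finset ℕ → ℝ := fun e => if h : e ∈ gramIndex S E then f (Pi.single ⟨e, h⟩ 1) else 0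
    have hω : ∀ e, e ∉ gramIndex S E → ω e = 0 := fun e he => dif_neg he
    have hfω : ∀ z, f z = ∑ e : gramIndex S E, z e * ω e.1 := by
      intro z
      rw [LinearMap.pi_apply_eq_sum_univ f z]
      refine Finset.sum_congr rfl fun e _ => ?_
      simp only [ω, dif_pos e.2, smul_eq_mul]
      congr 2
      ext j
      simp [Pi.single_apply, eq_comm]
    have hsum : ∀ (w : S) (i : Fin 3), ∑ v : S, ω {w.1, v.1} * p v i = 0 := by
      intro w i
      have h1 := sum_mul_gramEntryDeriv_single hω x w i
      have h2 : f _ = 0 := hle (LinearMap.mem_range_self _ (Pi.single (w, i) 1))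
      rw [hfω] at h2
      have h3 := h1.symm.trans h2
      simpa [hx] using h3
    have hvec : ∀ u ∈ S, ∑ v ∈ S, ω {u, v} • p v = 0 := by
      intro u hu
      ext i
      have := hsum ⟨u, hu⟩ i
      rw [Finset.sum_coe_sort S fun v => ω {u, v} * p v i] at this
      simpa using this
    have hpair : ∀ u v : ℕ, u ≠ v → ({u, v} : Finset ℕ) ∉ E → ω {u, v} = 0 := by
      intro u v huv he
      refine hω _ fun h => ?_
      rw [Finset.mem_union, Finset.mem_image] at h
      rcases h with h | ⟨a, -, ha⟩
      · exact he h
      · have := congrArg Finset.card ha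
        rw [Finset.card_pair huv] at this
        simp at this
    have hωE : ∀ e ∈ E, ω e = 0 := by
      have := hp (fun e => if e ∈ E then ω e else 0) (fun e he => if_neg he) fun u hu => by
        rw [← (crossProduct (p u)).map_zero, ← hvec u hu, map_sum]
        refine Finset.sum_congr rfl fun v hv => ?_
        rw [map_smul]
        by_cases huv : u = v
        · subst huv
          simp [cross_self]
        · by_cases he : ({u, v} : Finset ℕ) ∈ E
          · simp [he]
          · simp [he, hpair u v huv he]
      intro e he
      simpa [he] using congrFun this e
    have hωS : ∀ u ∈ S, ω {u} = 0 := by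
      intro u hu
      have := hvec u hu
      rw [Finset.sum_eq_single u] at this
      · simpa [h0 u] using this
      · intro v _ hvu
        by_cases he : ({u, v} : Finset ℕ) ∈ E
        · rw [hωE _ he, zero_smul]
        · rw [hpair u v hvu.symm he, zero_smul]
      · exact fun h => absurd hu h
    refine LinearMap.ext fun z => ?_
    rw [hfω, LinearMap.zero_apply]
    refine Finset.sum_eq_zero fun e _ => ?_
    rcases Finset.mem_union.1 e.2 with h | h
    · rw [hωE _ h, mul_zero]
    · obtain ⟨u, hu, hue⟩ := Finset.mem_image.1 h
      rw [← hue, hωS u hu, mul_zero]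
  have := hd.map_nhds_eq_of_surj hsurj
  rw [← this]
  exact Filter.image_mem_map Filter.univ_mem |> Filter.mem_of_superset <| by simp

end RealRealizations

theorem AlgebraicIndependent.add_ratCast {ι : Type} {x : ι → ℝ} (hx : AlgebraicIndependent ℚ x)
    (r : ι → ℚ) : AlgebraicIndependent ℚ fun i => x i + (r i : ℝ) := by
  let φ : MvPolynomial ι ℚ →ₐ[ℚ] MvPolynomial ι ℚ :=
    MvPolynomial.aeval fun i => MvPolynomial.X i + MvPolynomial.C (r i)
  let ψ : MvPolynomial ι ℚ →ₐ[ℚ] MvPolynomial ι ℚ :=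
    MvPolynomial.aeval fun i => MvPolynomial.X i - MvPolynomial.C (r i)
  have hψ : ψ.comp φ = AlgHom.id ℚ _ := by
    ext i
    simp [φ, ψ, MvPolynomial.algHom_C]
  have hinj : Function.Injective φ :=
    Function.LeftInverse.injective (g := ψ) fun f => DFunLike.congr_fun hψ f
  have hcomp : MvPolynomial.aeval (R := ℚ) (fun i => x i + (r i : ℝ)) =
      (MvPolynomial.aeval x).comp φ := by
    ext i
    simp [φ, MvPolynomial.algHom_C]
  rw [algebraicIndependent_iff_injective_aeval, hcomp]
  rw [AlgHom.coe_comp]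
  exact Function.Injective.comp (show Function.Injective (MvPolynomial.aeval x) from hx) hinj

theorem exists_rat_nonempty_sphereClasses {G : GeoGraph} {p : ℕ → Fin 3 → ℝ}
    (hp : StressFree G.V G.E p) (h0 : ∀ u, p u ≠ 0) (lam : Finset ℕ → ℝ) :
    ∃ r : Finset ℕ → ℚ, Nonempty (SphereClasses G fun e => lam e + r e) := by
  set x : G.V × Fin 3 → ℝ := fun k => p k.1 k.2 with hx
  let N : ℕ → ℝ := fun u => √(∑ i, p u i ^ 2)
  have hsum : ∀ u, 0 < ∑ i, p u i ^ 2 := by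
    intro u
    obtain ⟨i, hi⟩ := Function.ne_iff.1 (h0 u)
    exact Finset.sum_pos' (fun i _ => sq_nonneg _) ⟨i, Finset.mem_univ i, by
      have : p u i ≠ 0 := hi
      positivity⟩
  have hN : ∀ u, N u ≠ 0 := fun u => (Real.sqrt_pos.2 (hsum u)).ne'
  have hNsq : ∀ u, N u ^ 2 = ∑ i, p u i ^ 2 := fun u => Real.sq_sqrt (hsum u).le
  have hP : ∀ e : Finset ℕ, ∏ u ∈ e, N u ≠ 0 := fun e => Finset.prod_ne_zero_iff.2 fun u _ => hN u
  let z : (gramIndex G.V G.E → ℝ) → gramIndex G.V G.E → ℝ := fun μ e =>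
    if e.1 ∈ G.E then (2 - μ e) * ∏ u ∈ e.1, N u else gramEntry x e.1
  have hz : Continuous z := by
    refine continuous_pi fun e => ?_
    by_cases he : e.1 ∈ G.E
    · simp only [z, if_pos he]
      fun_prop
    · simp only [z, if_neg he]
      fun_prop
  let μ₀ : Finset ℕ → ℝ := fun e => 2 - gramEntry x e / ∏ u ∈ e, N u
  have hzμ : z (fun e => μ₀ e.1) = fun e => gramEntry x e.1 := by
    ext e
    simp only [z, μ₀]
    split_ifs
    · rw [sub_sub_cancel, div_mul_cancel₀ _ (hP _)]
    · rfl
  have hnhds := hz.continuousAt.preimage_mem_nhds (hzμ ▸ range_gramEntry_mem_nhds hp h0)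
  obtain ⟨ε, hε, hball⟩ := Metric.mem_nhds_iff.1 hnhds
  choose r hr using fun e : Finset ℕ =>
    exists_rat_btwn (show μ₀ e - lam e - ε < μ₀ e - lam e + ε by linarith)
  obtain ⟨y, hy⟩ := hball (show (fun e : gramIndex G.V G.E => lam e.1 + r e.1) ∈ _ by
    rw [Metric.mem_ball, dist_pi_lt_iff hε]
    intro e
    rw [Real.dist_eq, abs_lt]
    constructor <;> linarith [(hr e.1).1, (hr e.1).2])
  have hyE : ∀ e, ∀ he : e ∈ G.E, gramEntry y e = (2 - (lam e + r e)) * ∏ u ∈ e, N u := by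
    intro e he
    simpa [z, he] using congrFun hy ⟨e, Finset.mem_union_left _ he⟩
  have hyV : ∀ u : G.V, ∑ i, y (u, i) ^ 2 = N u.1 ^ 2 := by
    intro u
    have hmem : ({u.1} : Finset ℕ) ∈ gramIndex G.V G.E :=
      Finset.mem_union_right _ (Finset.mem_image_of_mem _ u.2)
    have hnot : ({u.1} : Finset ℕ) ∉ G.E := fun h => by simpa using G.edge_two _ h
    have := congrFun hy ⟨{u.1}, hmem⟩
    simp only [z, if_neg hnot, gramEntry_singleton] at this
    rw [this, hNsq]
  let q : ℕ → Fin 3 → ℝ := fun u i => if hu : u ∈ G.V then y (⟨u, hu⟩, i) / N u else 0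
  have hqV : ∀ u ∈ G.V, ∑ i, q u i ^ 2 = 1 := by
    intro u hu
    simp only [q, dif_pos hu, div_pow]
    rw [← Finset.sum_div, hyV ⟨u, hu⟩, div_self (pow_ne_zero 2 (hN u))]
  refine ⟨r, ⟨Quot.mk _ ⟨fun u i => (q u i : ℂ), fun u hu => ?_, fun u v huv => ?_⟩⟩⟩
  · have := hqV u hu
    beta_reduce
    exact_mod_cast this
  · have huv' : u ≠ v := by
      rintro rfl
      simpa using G.edge_two _ huv
    have hu : u ∈ G.V := G.edge_sub _ huv (by simp)
    have hv : v ∈ G.V := G.edge_sub _ huv (by simp)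
    have hinner : 2 * ∑ i, q u i * q v i = 2 - (lam {u, v} + r {u, v}) := by
      have h1 := hyE _ huv
      rw [gramEntry_pair y (u := ⟨u, hu⟩) (v := ⟨v, hv⟩) (by simpa using huv'),
        Finset.prod_pair huv'] at h1
      refine mul_right_cancel₀ (mul_ne_zero (hN u) (hN v)) ?_
      rw [← h1, mul_assoc, Finset.sum_mul]
      congr 1
      refine Finset.sum_congr rfl fun i _ => ?_
      simp only [q, dif_pos hu, dif_pos hv]
      have := hN u
      have := hN v
      field_simp
    have : ∑ i, (q u i - q v i) ^ 2 = lam {u, v} + r {u, v} := by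
      have h1 := hqV u hu
      have h2 := hqV v hv
      simp only [Fin.sum_univ_three] at *
      linarith
    beta_reduce
    exact_mod_cast this

theorem Laman.nonempty_sphereClasses {G : GeoGraph} (hG : Laman G) {lam : Finset ℕ → ℝ}
    (hlam : AlgebraicIndependent ℚ (fun e : G.E => lam e.1)) : Nonempty (SphereClasses G lam) := by
  obtain ⟨p, hp⟩ := hG.sparse.exists_stressFree G.edge_two G.edge_sub
  obtain ⟨q, hq, hq0⟩ := hp.exists_ne_zero
  obtain ⟨r, hr⟩ := exists_rat_nonempty_sphereClasses hq hq0 lam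
  obtain ⟨f⟩ := SphereClasses.nonempty_equiv (lam := fun e => lam e + r e) (lam' := lam)
    (hlam.add_ratCast fun e => r e.1) hlam
  exact hr.map f

/-- For a minimally rigid graph, the number of congruence classes of spherical
realizations is the same for all generic edge-length assignments. -/
theorem sphere_count_independent_of_generic_lengths (G : GeoGraph) (hG : Laman G)
    (lam lam' : Finset ℕ → ℝ) (hlam : Generic G lam) (hlam' : Generic G lam') :
    Finite (SphereClasses G lam) ∧ Finite (SphereClasses G lam') ∧
    Nonempty (SphereClasses G lam) ∧ Nonempty (SphereClasses G lam') ∧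
    Nat.card (SphereClasses G lam) = Nat.card (SphereClasses G lam') := by
  obtain ⟨f⟩ := SphereClasses.nonempty_equiv hlam.2 hlam'.2
  exact ⟨sphereClasses_finite hG.2.1 hG.1 hlam.2, sphereClasses_finite hG.2.1 hG.1 hlam'.2,
    hG.nonempty_sphereClasses hlam.2, hG.nonempty_sphereClasses hlam'.2, Nat.card_congr f⟩
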